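/- arXiv:math/0402240 — 2 statements merged into one kernel-verified Lean document; each statement's English description precedes it below -/
import Mathlib

section
/- Let U be an open subset of the complex projective plane ℙ² (or more generally ℙ^N) containing a complex projective line Δ. Then every function f meromorphic on U, whose restriction to each line of a suitable N-parameter family of affine coordinate lines contained in U is rational, is itself rational: f extends to a rational function on ℙ^N. In particular (Kneser, N = 2): if f is meromorphic on a neighborhood of 0 in ℂ² and for each fixed generic x the function y ↦ f(x,y) is rational, and for each fixed generic y the function x ↦ f(x,y) is rational, then f is a rational function of (x,y). -/
open MvPolynomial

/-- zeros of a nonzero holomorphic function on the disk are countable -/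
lemma kn_countable (φ : ℂ → ℂ) (hφ : DifferentiableOn ℂ φ (Metric.ball 0 1))
    (x₀ : ℂ) (hx₀ : x₀ ∈ Metric.ball (0 : ℂ) 1) (hne : φ x₀ ≠ 0) :
    {x : ℂ | x ∈ Metric.ball (0 : ℂ) 1 ∧ φ x = 0}.Countable := by
  have han : AnalyticOnNhd ℂ φ (Metric.ball 0 1) := hφ.analyticOnNhd Metric.isOpen_ball
  obtain ⟨t, hts, htc, hcov⟩ := TopologicalSpace.countable_cover_nhdsWithin
    (s := {x : ℂ | x ∈ Metric.ball (0 : ℂ) 1 ∧ φ x = 0})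
    (f := fun z => {w | φ w = 0 → w = z}) (by
      rintro z ⟨hz, hz0⟩
      apply mem_nhdsWithin_of_mem_nhds
      by_contra hcon
      apply hne
      have hf : ∃ᶠ w in nhdsWithin z {z}ᶜ, φ w = 0 := by
        intro h
        apply hcon
        rw [eventually_nhdsWithin_iff] at h
        filter_upwards [h] with w hw h0
        by_contra hwz
        exact hw hwz h0
      exact han.eqOn_zero_of_preconnected_of_frequently_eq_zero
        (convex_ball (0 : ℂ) 1).isPreconnected hz hf hx₀)
  refine htc.mono ?_
  intro w hw
  obtain ⟨z, hz, hwz⟩ := Set.mem_iUnion₂.1 (hcov hw)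
  rw [hwz hw.2]
  exact hz

lemma kn_ball_not_countable : ¬ (Metric.ball (0 : ℂ) 1).Countable := by
  intro h
  have h1 := h.dense_compl ℂ
  obtain ⟨x, hx, hx'⟩ := h1.inter_open_nonempty _ Metric.isOpen_ball
    ⟨0, Metric.mem_ball_self one_pos⟩
  exact hx' hx

/-- the disk minus a countable set is nonempty -/
lemma kn_exists (C : Set ℂ) (hC : C.Countable) : ∃ x ∈ Metric.ball (0 : ℂ) 1, x ∉ C := by
  by_contra hcon
  push Not at hcon
  exact kn_ball_not_countable (hC.mono hcon)

/-- identity principle -/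
lemma kn_zero (φ : ℂ → ℂ) (hφ : DifferentiableOn ℂ φ (Metric.ball 0 1)) (C : Set ℂ)
    (hC : C.Countable) (h : ∀ x ∈ Metric.ball (0 : ℂ) 1, x ∉ C → φ x = 0)
    (x : ℂ) (hx : x ∈ Metric.ball (0 : ℂ) 1) : φ x = 0 := by
  by_contra hne
  obtain ⟨z, hz, hz'⟩ := kn_exists _ ((kn_countable φ hφ x hx hne).union hC)
  exact hz' (Or.inl ⟨hz, h z hz fun hc => hz' (Or.inr hc)⟩)

lemma kn_roots (q : Polynomial ℂ) (hq : q ≠ 0) : {x : ℂ | q.eval x = 0}.Countable :=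
  (Polynomial.finite_setOfPred_isRoot hq).countable

lemma kn_alg {α ι : Type} [Fintype ι] [DecidableEq ι] (S : Set α)
    (w : α → ι → Polynomial ℂ)
    (hdet : ∀ a : ι → α, (∀ k, a k ∈ S) → (Matrix.of fun k i => w (a k) i).det = 0) :
    ∃ c : ι → Polynomial ℂ, c ≠ 0 ∧ ∀ a ∈ S, ∑ i, c i * w a i = 0 := by
  classical
  let K := FractionRing (Polynomial ℂ)
  let A : Polynomial ℂ →+* K := algebraMap (Polynomial ℂ) K
  have hA : Function.Injective A := IsFractionRing.injective _ _
  let W : α → ι → K := fun a i => A (w a i)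
  have hlt : Submodule.span K (W '' S) < ⊤ := by
    rw [lt_top_iff_ne_top]
    intro htop
    obtain ⟨f, hfS, -, hli⟩ := Submodule.exists_fun_fin_finrank_span_eq K (W '' S)
    have hcard : Module.finrank K (Submodule.span K (W '' S)) = Fintype.card ι := by
      rw [htop, finrank_top, Module.finrank_fintype_fun_eq_card]
    let e : ι ≃ Fin (Module.finrank K (Submodule.span K (W '' S))) :=
      (Fintype.equivFin ι).trans (finCongr hcard.symm)
    choose b hbS hb using hfS
    have hli2 : LinearIndependent K (fun k => f (e k)) := hli.comp _ e.injective
    have hz := hdet (fun k => b (e k)) (fun k => hbS _)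
    have hz2 : (Matrix.of fun k i => W (b (e k)) i).det = 0 := by
      have := congrArg A hz
      rw [RingHom.map_det, map_zero] at this
      exact this
    have hli3 : LinearIndependent K (Matrix.of fun k i => W (b (e k)) i).row := by
      convert hli2 using 1
      funext k
      exact hb (e k)
    rw [Matrix.linearIndependent_rows_iff_isUnit, Matrix.isUnit_iff_isUnit_det, hz2] at hli3
    exact not_isUnit_zero hli3
  obtain ⟨F, hF, hle⟩ := Submodule.exists_le_ker_of_lt_top _ hlt
  obtain ⟨b, hb⟩ := IsLocalization.exist_integer_multiples_of_finite
    (nonZeroDivisors (Polynomial ℂ)) (fun i : ι => F (Pi.single i 1))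
  choose c hc using hb
  have hb0 : A (b : Polynomial ℂ) ≠ 0 := by
    rw [Ne, map_eq_zero_iff A hA]
    exact nonZeroDivisors.coe_ne_zero b
  have hc' : ∀ i, A (c i) = A b * F (Pi.single i 1) := by
    intro i
    rw [← Algebra.smul_def]; exact hc i
  have hFv : ∀ v : ι → K, F v = ∑ i, v i * F (Pi.single i 1) := by
    intro v
    conv_lhs => rw [pi_eq_sum_univ' v]
    simp [map_sum]
  refine ⟨c, ?_, ?_⟩
  · intro h0
    apply hF
    apply LinearMap.ext
    intro v
    rw [hFv]
    refine Finset.sum_eq_zero fun i _ => ?_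
    have := hc' i
    rw [h0] at this
    simp only [Pi.zero_apply, map_zero] at this
    rcases mul_eq_zero.1 this.symm with h | h
    · exact absurd h hb0
    · rw [h, mul_zero]
  · intro a ha
    apply hA
    have h1 : F (W a) = 0 := hle (Submodule.subset_span ⟨a, ha, rfl⟩)
    rw [hFv] at h1
    rw [map_zero, map_sum]
    calc ∑ i, A (c i * w a i) = A b * ∑ i, W a i * F (Pi.single i 1) := by
          rw [Finset.mul_sum]
          refine Finset.sum_congr rfl fun i _ => ?_
          rw [map_mul, hc']; simp only [W]; ring
      _ = 0 := by rw [h1, mul_zero]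

/-- the row vector -/
noncomputable def knRow {R : Type} [CommRing R] (n : ℕ) (y a b : R) :
    Fin (n + 1) ⊕ Fin (n + 1) → R :=
  Sum.elim (fun i => y ^ (i : ℕ) * a) (fun j => y ^ (j : ℕ) * b)

lemma knRow_smul {R : Type} [CommRing R] (n : ℕ) (y a b s a' b' t : R)
    (h1 : s * a = t * a') (h2 : s * b = t * b') (i) :
    s * knRow n y a b i = t * knRow n y a' b' i := by
  rcases i with i | i
  · simp only [knRow, Sum.elim_inl]; linear_combination y ^ (i : ℕ) * h1
  · simp only [knRow, Sum.elim_inr]; linear_combination y ^ (i : ℕ) * h2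

/-- Kneser's theorem: a meromorphic function `f = g/h` on the
unit polydisk in `ℂ²` which is rational in `y` for every `x` outside a thin
(countable) exceptional set, and rational in `x` for every `y` outside a thin
exceptional set, is rational: it agrees on the polydisk with a quotient of
two-variable polynomials. -/
theorem kneser_separately_rational_implies_rational
    (g h : ℂ × ℂ → ℂ)
    (hg : DifferentiableOn ℂ g {p : ℂ × ℂ | ‖p.1‖ < 1 ∧ ‖p.2‖ < 1})
    (hh : DifferentiableOn ℂ h {p : ℂ × ℂ | ‖p.1‖ < 1 ∧ ‖p.2‖ < 1})
    (hne : ∃ p : ℂ × ℂ, ‖p.1‖ < 1 ∧ ‖p.2‖ < 1 ∧ h p ≠ 0)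
    (hraty : ∃ E : Set ℂ, E.Countable ∧ ∀ x : ℂ, ‖x‖ < 1 → x ∉ E →
      ∃ p q : Polynomial ℂ, q ≠ 0 ∧ ∀ y : ℂ, ‖y‖ < 1 →
        q.eval y * g (x, y) = p.eval y * h (x, y))
    (hratx : ∃ E : Set ℂ, E.Countable ∧ ∀ y : ℂ, ‖y‖ < 1 → y ∉ E →
      ∃ p q : Polynomial ℂ, q ≠ 0 ∧ ∀ x : ℂ, ‖x‖ < 1 →
        q.eval x * g (x, y) = p.eval x * h (x, y)) :
    ∃ p q : MvPolynomial (Fin 2) ℂ, q ≠ 0 ∧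
      ∀ x y : ℂ, ‖x‖ < 1 → ‖y‖ < 1 →
        MvPolynomial.eval (fun i : Fin 2 => if i = 0 then x else y) q * g (x, y) =
        MvPolynomial.eval (fun i : Fin 2 => if i = 0 then x else y) p * h (x, y) := by
  classical
  have hball : ∀ x : ℂ, x ∈ Metric.ball (0 : ℂ) 1 ↔ ‖x‖ < 1 := fun x => mem_ball_zero_iff
  have slx : ∀ u : ℂ × ℂ → ℂ, DifferentiableOn ℂ u {p : ℂ × ℂ | ‖p.1‖ < 1 ∧ ‖p.2‖ < 1} →
      ∀ y, ‖y‖ < 1 → DifferentiableOn ℂ (fun x => u (x, y)) (Metric.ball 0 1) := by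
    intro u hu y hy
    exact hu.comp (f := fun x : ℂ => (x, y)) (by fun_prop) fun x hx => ⟨(hball x).1 hx, hy⟩
  have sly : ∀ u : ℂ × ℂ → ℂ, DifferentiableOn ℂ u {p : ℂ × ℂ | ‖p.1‖ < 1 ∧ ‖p.2‖ < 1} →
      ∀ x, ‖x‖ < 1 → DifferentiableOn ℂ (fun y => u (x, y)) (Metric.ball 0 1) := by
    intro u hu x hx
    exact hu.comp (f := fun y : ℂ => (x, y)) (by fun_prop) fun y hy => ⟨hx, (hball y).1 hy⟩
  obtain ⟨⟨x₀, y₀⟩, hx₀, hy₀, h0⟩ := hne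
  simp only at hx₀ hy₀
  obtain ⟨E, hE, hrat1⟩ := hraty
  obtain ⟨E', hE', hrat2⟩ := hratx
  -- uniform degree on an uncountable set
  obtain ⟨n, hn⟩ : ∃ n : ℕ, ¬ {x : ℂ | x ∈ Metric.ball (0 : ℂ) 1 ∧ ∃ p q : Polynomial ℂ,
      q ≠ 0 ∧ p.natDegree < n + 1 ∧ q.natDegree < n + 1 ∧ ∀ y : ℂ, ‖y‖ < 1 →
        q.eval y * g (x, y) = p.eval y * h (x, y)}.Countable := by
    by_contra hcon
    push Not at hcon
    obtain ⟨x, hx, hx'⟩ := kn_exists _ ((Set.countable_iUnion hcon).union hE)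
    apply hx'
    left
    obtain ⟨p, q, hq, hpq⟩ := hrat1 x ((hball x).1 hx) fun hc => hx' (Or.inr hc)
    exact Set.mem_iUnion.2 ⟨max p.natDegree q.natDegree, hx, p, q, hq,
      Nat.lt_succ_of_le (le_max_left _ _), Nat.lt_succ_of_le (le_max_right _ _), hpq⟩
  -- the determinant vanishes identically
  have hdet0 : ∀ a : Fin (n + 1) ⊕ Fin (n + 1) → ℂ, (∀ k, ‖a k‖ < 1) → ∀ x, ‖x‖ < 1 →
      (Matrix.of fun k i => knRow n (a k) (g (x, a k)) (h (x, a k)) i).det = 0 := by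
    intro a ha
    by_contra hcon
    push Not at hcon
    obtain ⟨x, hx, hxne⟩ := hcon
    apply hn
    refine (kn_countable (fun x =>
      (Matrix.of fun k i => knRow n (a k) (g (x, a k)) (h (x, a k)) i).det) ?_ x
      ((hball x).2 hx) hxne).mono ?_
    · simp only [Matrix.det_apply, Matrix.of_apply]
      refine DifferentiableOn.fun_sum fun σ _ => ?_
      refine DifferentiableOn.const_smul ?_ _
      refine DifferentiableOn.fun_finsetProd fun k _ => ?_
      rcases k with k | k
      · simp only [knRow, Sum.elim_inl]
        exact (slx g hg _ (ha _)).const_mul _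
      · simp only [knRow, Sum.elim_inr]
        exact (slx h hh _ (ha _)).const_mul _
    · rintro z ⟨hz, p, q, hq, hpd, hqd, hpq⟩
      refine ⟨hz, ?_⟩
      rw [← Matrix.exists_mulVec_eq_zero_iff]
      refine ⟨Sum.elim (fun i => q.coeff i) (fun j => - p.coeff j), ?_, ?_⟩
      · intro hv
        apply hq
        ext i
        by_cases hi : i < n + 1
        · exact congrFun hv (Sum.inl ⟨i, hi⟩)
        · exact Polynomial.coeff_eq_zero_of_natDegree_lt (by omega)
      · funext k
        have := hpq (a k) (ha k)
        rw [Polynomial.eval_eq_sum_range' hqd, Polynomial.eval_eq_sum_range' hpd,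
          Finset.sum_range, Finset.sum_range, Finset.sum_mul, Finset.sum_mul] at this
        simp only [Matrix.mulVec, dotProduct, Matrix.of_apply, Fintype.sum_sum_type, knRow,
          Sum.elim_inl, Sum.elim_inr, Pi.zero_apply, mul_neg, Finset.sum_neg_distrib]
        rw [← sub_eq_add_neg, sub_eq_zero]
        refine Eq.trans ?_ (this.trans ?_)
        · exact Finset.sum_congr rfl fun i _ => by ring
        · exact Finset.sum_congr rfl fun i _ => by ring
  -- good values of y
  let B : Set ℂ := E' ∪ {y | y ∈ Metric.ball (0 : ℂ) 1 ∧ h (x₀, y) = 0}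
  have hB : B.Countable := hE'.union
    (kn_countable (fun y => h (x₀, y)) (sly h hh x₀ hx₀) y₀ ((hball _).2 hy₀) h0)
  let S : Set ℂ := {y | ‖y‖ < 1 ∧ y ∉ B}
  have hS : ∀ y : ℂ, ∃ p q : Polynomial ℂ, y ∈ S → q ≠ 0 ∧ ∀ x : ℂ, ‖x‖ < 1 →
        q.eval x * g (x, y) = p.eval x * h (x, y) := by
    intro y
    by_cases hy : y ∈ S
    · obtain ⟨p, q, hpq⟩ := hrat2 y hy.1 fun hc => hy.2 (Or.inl hc)
      exact ⟨p, q, fun _ => hpq⟩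
    · exact ⟨0, 0, fun hc => absurd hc hy⟩
  choose P Q hPQ using hS
  obtain ⟨c, hc0, hc⟩ := kn_alg S (fun y => knRow n (Polynomial.C y) (P y) (Q y)) (by
    intro a ha
    by_contra hdet
    -- choose x with nonvanishing determinant and h (x, a k)
    have hcount : ∀ k, {x : ℂ | x ∈ Metric.ball (0 : ℂ) 1 ∧ h (x, a k) = 0}.Countable := by
      intro k
      refine kn_countable (fun x => h (x, a k)) (slx h hh _ (ha k).1) x₀ ((hball _).2 hx₀) ?_
      intro hz
      exact (ha k).2 (Or.inr ⟨(hball _).2 (ha k).1, hz⟩)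
    obtain ⟨x, hx, hx'⟩ := kn_exists _ ((Set.countable_iUnion hcount).union (kn_roots _ hdet))
    have hx1 := (hball x).1 hx
    apply hx'
    by_cases hex : ∃ k, h (x, a k) = 0
    · obtain ⟨k, hk⟩ := hex
      exact Or.inl (Set.mem_iUnion.2 ⟨k, hx, hk⟩)
    push Not at hex
    right
    show Polynomial.eval x _ = 0
    rw [← Polynomial.coe_evalRingHom, RingHom.map_det]
    have e1 := Matrix.det_mul_column (fun k => (Q (a k)).eval x)
      (Matrix.of fun k i => knRow n (a k) (g (x, a k)) (h (x, a k)) i)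
    have e2 := Matrix.det_mul_column (fun k => h (x, a k))
      ((Polynomial.evalRingHom x).mapMatrix
        (Matrix.of fun k i => knRow n (Polynomial.C (a k)) (P (a k)) (Q (a k)) i))
    rw [hdet0 a (fun k => (ha k).1) x hx1, mul_zero] at e1
    have e3 : ∀ k i, (Polynomial.evalRingHom x)
        (knRow n (Polynomial.C (a k)) (P (a k)) (Q (a k)) i) =
        knRow n (a k) ((P (a k)).eval x) ((Q (a k)).eval x) i := by
      rintro k (i | i) <;> simp [knRow]
    have e4 : (∏ k, h (x, a k)) * ((Polynomial.evalRingHom x).mapMatrix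
        (Matrix.of fun k i => knRow n (Polynomial.C (a k)) (P (a k)) (Q (a k)) i)).det = 0 := by
      rw [← e2, ← e1]
      congr 1
      ext k i
      simp only [Matrix.of_apply, RingHom.mapMatrix_apply, Matrix.map_apply]
      rw [e3]
      refine (knRow_smul _ _ _ _ _ _ _ _ ?_ ?_ _).symm
      · rw [(hPQ (a k) (ha k)).2 x hx1, mul_comm]
      · rw [mul_comm]
    exact (mul_eq_zero.1 e4).resolve_left (Finset.prod_ne_zero_iff.2 fun k _ => hex k))
  -- the identity
  have hid0 : ∀ x y : ℂ, ‖x‖ < 1 → ‖y‖ < 1 →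
      (∑ i : Fin (n + 1), (c (Sum.inl i)).eval x * y ^ (i : ℕ)) * g (x, y) +
      (∑ i : Fin (n + 1), (c (Sum.inr i)).eval x * y ^ (i : ℕ)) * h (x, y) = 0 := by
    intro x y hx hy
    refine kn_zero (fun y => (∑ i : Fin (n + 1), (c (Sum.inl i)).eval x * y ^ (i : ℕ)) * g (x, y) +
      (∑ i : Fin (n + 1), (c (Sum.inr i)).eval x * y ^ (i : ℕ)) * h (x, y)) ?_ B hB ?_ y
      ((hball y).2 hy)
    · exact (DifferentiableOn.mul (by fun_prop) (sly g hg x hx)).add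
        (DifferentiableOn.mul (by fun_prop) (sly h hh x hx))
    clear y hy
    intro y hy hyB
    have hy := (hball y).1 hy
    obtain ⟨hq, hpq⟩ := hPQ y ⟨hy, hyB⟩
    refine kn_zero (fun x => (∑ i : Fin (n + 1), (c (Sum.inl i)).eval x * y ^ (i : ℕ)) * g (x, y) +
      (∑ i : Fin (n + 1), (c (Sum.inr i)).eval x * y ^ (i : ℕ)) * h (x, y)) ?_ _
      (kn_roots _ hq) ?_ x ((hball x).2 hx)
    · have := slx g hg y hy
      have := slx h hh y hy
      have hpoly : ∀ p : Polynomial ℂ, Differentiable ℂ (fun x => p.eval x) :=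
        fun p => p.differentiable
      have h3 : ∀ i : Fin (n + 1) ⊕ Fin (n + 1),
        DifferentiableOn ℂ (fun x => (c i).eval x) (Metric.ball 0 1) :=
        fun i => (hpoly (c i)).differentiableOn
      refine ((DifferentiableOn.fun_sum fun i _ => (h3 _).mul_const _).mul ?_).add
        ((DifferentiableOn.fun_sum fun i _ => (h3 _).mul_const _).mul ?_) <;> assumption
    clear x hx
    intro x hx hxr
    have hx := (hball x).1 hx
    have hxr : (Q y).eval x ≠ 0 := hxr
    have h5 := congrArg (Polynomial.eval x) (hc y ⟨hy, hyB⟩)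
    simp only [knRow, Fintype.sum_sum_type, Sum.elim_inl, Sum.elim_inr, Polynomial.eval_add,
      Polynomial.eval_finsetSum, Polynomial.eval_mul, Polynomial.eval_pow, Polynomial.eval_C,
      Polynomial.eval_zero] at h5
    have h6 := hpq x hx
    apply (mul_eq_zero.1 _).resolve_left hxr
    simp only [← mul_assoc, ← Finset.sum_mul] at h5
    linear_combination (∑ i : Fin (n + 1), (c (Sum.inl i)).eval x * y ^ (i : ℕ)) * h6
      + h (x, y) * h5
  -- conclude
  let toMv : (Fin (n + 1) → Polynomial ℂ) → MvPolynomial (Fin 2) ℂ := fun d =>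
    ∑ i : Fin (n + 1), Polynomial.aeval (X 0 : MvPolynomial (Fin 2) ℂ) (d i) * X 1 ^ (i : ℕ)
  have htoMv : ∀ d x y, MvPolynomial.eval (fun i : Fin 2 => if i = 0 then x else y) (toMv d) =
      ∑ i : Fin (n + 1), (d i).eval x * y ^ (i : ℕ) := by
    intro d x y
    simp only [toMv, map_sum, map_mul, map_pow, MvPolynomial.eval_X]
    refine Finset.sum_congr rfl fun i _ => ?_
    have : ∀ p : Polynomial ℂ, MvPolynomial.eval (fun i : Fin 2 => if i = 0 then x else y)
        (Polynomial.aeval (X 0 : MvPolynomial (Fin 2) ℂ) p) = p.eval x := by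
      intro p
      induction p using Polynomial.induction_on' with
      | add p q hp hq => simp [hp, hq]
      | monomial k r => simp [Polynomial.aeval_monomial, MvPolynomial.algebraMap_eq]
    rw [this]
    simp
  have hnz : ∀ (d : Fin (n + 1) → Polynomial ℂ) (j : Fin (n + 1)) (x : ℂ), (d j).eval x ≠ 0 →
      {y : ℂ | ∑ i : Fin (n + 1), (d i).eval x * y ^ (i : ℕ) = 0}.Countable := by
    intro d j x hj
    have hr : (∑ i : Fin (n + 1), Polynomial.C ((d i).eval x) * Polynomial.X ^ (i : ℕ)) ≠ 0 := by
      intro h0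
      apply hj
      have := congrArg (fun p => Polynomial.coeff p j) h0
      simp only [Polynomial.finsetSum_coeff, Polynomial.coeff_C_mul_X_pow,
        Polynomial.coeff_zero] at this
      rw [Finset.sum_eq_single j] at this
      · simpa using this
      · intro b _ hb
        rw [if_neg]
        intro hh
        exact hb (Fin.ext hh.symm)
      · simp
    refine (kn_roots _ hr).mono ?_
    intro y hy
    simpa [Polynomial.eval_finsetSum] using hy
  refine ⟨toMv fun i => - c (Sum.inr i), toMv fun i => c (Sum.inl i), ?_, ?_⟩
  · intro hQ0
    have hl : ∀ i, c (Sum.inl i) = 0 := by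
      intro i
      by_contra hi
      obtain ⟨x, -, hx⟩ := kn_exists _ (kn_roots _ hi)
      obtain ⟨y, -, hy⟩ := kn_exists _ (hnz (fun i => c (Sum.inl i)) i x hx)
      apply hy
      show _ = _
      rw [← htoMv, hQ0, map_zero]
    obtain ⟨j, hj⟩ : ∃ j, c (Sum.inr j) ≠ 0 := by
      by_contra hcon
      push Not at hcon
      apply hc0
      funext i
      rcases i with i | i
      · exact hl i
      · exact hcon i
    obtain ⟨x, hx, hx'⟩ := kn_exists _ ((kn_roots _ hj).union
      (kn_countable (fun x => h (x, y₀)) (slx h hh y₀ hy₀) x₀ ((hball _).2 hx₀) h0))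
    have hx1 := (hball x).1 hx
    obtain ⟨y, hy, hy'⟩ := kn_exists _ ((hnz (fun i => c (Sum.inr i)) j x
      fun hc => hx' (Or.inl hc)).union
      (kn_countable (fun y => h (x, y)) (sly h hh x hx1) y₀ ((hball _).2 hy₀)
        fun hc => hx' (Or.inr ⟨hx, hc⟩)))
    have := hid0 x y hx1 ((hball _).1 hy)
    simp only [hl, Polynomial.eval_zero, zero_mul, Finset.sum_const_zero, zero_add] at this
    rcases mul_eq_zero.1 this with hz | hz
    · exact hy' (Or.inl hz)
    · exact hy' (Or.inr ⟨hy, hz⟩)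
  · intro x y hx hy
    rw [htoMv, htoMv]
    have := hid0 x y hx hy
    simp only [Polynomial.eval_neg, neg_mul, Finset.sum_neg_distrib]
    linear_combination this
end

section
/- Let φ : ℂ^n × ℂ → ℂ^n be the standard projection, P(x,y) = y^d + a_1(x) y^{d-1} + ⋯ + a_d(x) a monic polynomial in y with coefficients holomorphic on a domain D ⊂ ℂ^n, and suppose the zero set Z = {(x,y) ∈ D × ℂ : P(x,y) = 0} is such that φ|_Z : Z → D is proper. Conversely, suppose Z ⊂ D × ℂ is an analytic hypersurface, φ|_Z proper with fibers of cardinality ≤ d, and meromorphic coefficients a_i on D with Z = {P = 0} over a dense Zariski-open D' ⊂ D. Then each a_i is holomorphic on all of D. -/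
open Set

lemma aux_identity {U : Set ℂ} (hU : IsOpen U) (hc : IsPreconnected U) {H : ℂ → ℂ}
    (hH : DifferentiableOn ℂ H U) {z₀ z₁ : ℂ} (h₀ : z₀ ∈ U) (h₁ : z₁ ∈ U) (hne : H z₁ ≠ 0) :
    ∀ᶠ w in nhdsWithin z₀ {z₀}ᶜ, H w ≠ 0 := by
  by_contra hcon
  have hf : ∃ᶠ w in nhdsWithin z₀ {z₀}ᶜ, H w = 0 := by
    rw [Filter.not_eventually] at hcon
    exact hcon.mono fun w hw => not_not.1 hw
  exact hne ((hH.analyticOnNhd hU).eqOn_zero_of_preconnected_of_frequently_eq_zero hc h₀ hf h₁)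

lemma aux_line_pre {E : Type*} [NormedAddCommGroup E] [NormedSpace ℂ E] (p x v : E) (ρ : ℝ) :
    IsOpen {t : ℂ | x + t • v ∈ Metric.ball p ρ} ∧
    IsPreconnected {t : ℂ | x + t • v ∈ Metric.ball p ρ} := by
  constructor
  · exact Metric.isOpen_ball.preimage (by fun_prop : Continuous fun t : ℂ => x + t • v)
  · apply Convex.isPreconnected
    let _ : NormedSpace ℝ E := NormedSpace.restrictScalars ℝ ℂ E
    intro s hs t ht a b ha hb hab
    have := convex_ball p ρ hs ht ha hb hab
    simp only [mem_ofPred_eq] at *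
    convert this using 1
    have e1 : ∀ (c : ℝ) (y : E), c • y = (c : ℂ) • y := fun c y => rfl
    have hab' : (a : ℂ) + b = 1 := by exact_mod_cast hab
    rw [e1, e1, smul_add, smul_add, smul_smul, smul_smul, add_smul]
    have : x = (a : ℂ) • x + (b : ℂ) • x := by rw [← add_smul, hab', one_smul]
    simp only [Complex.real_smul]
    nth_rewrite 1 [this]
    abel

lemma aux_line_diff {E : Type*} [NormedAddCommGroup E] [NormedSpace ℂ E] {p : E} {ρ : ℝ}
    {h : E → ℂ} (hh : DifferentiableOn ℂ h (Metric.ball p ρ)) (x v : E) :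
    DifferentiableOn ℂ (fun t : ℂ => h (x + t • v)) {t : ℂ | x + t • v ∈ Metric.ball p ρ} :=
  hh.comp (by fun_prop) (fun t ht => ht)

lemma aux_dense {E : Type*} [NormedAddCommGroup E] [NormedSpace ℂ E] {D : Set E}
    (hD : IsOpen D) (hDc : IsPreconnected D) {h : E → ℂ} (hh : DifferentiableOn ℂ h D)
    (hne : ∃ x ∈ D, h x ≠ 0) {p : E} (hp : p ∈ D) : ∃ᶠ x in nhds p, h x ≠ 0 := by
  by_contra hcon
  have hz : ∀ᶠ x in nhds p, h x = 0 := by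
    rw [Filter.not_frequently] at hcon
    exact hcon.mono fun w hw => not_not.1 hw
  obtain ⟨y, hy, hyne⟩ := hne
  let A : Set E := {x | ∀ᶠ z in nhds x, h z = 0}
  have hA : IsOpen A := isOpen_setOfPred_eventually_nhds
  have := hDc.subset_of_closure_inter_subset hA ⟨p, hp, hz⟩ ?_
  · exact hyne (this hy).self_of_nhds
  · rintro x ⟨hx, hxD⟩
    obtain ⟨ρ, hρ, hb⟩ := Metric.isOpen_iff.1 hD x hxD
    obtain ⟨x₁, hx₁A, hx₁⟩ := Metric.mem_closure_iff.1 hx ρ hρ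
    rw [dist_comm] at hx₁
    show ∀ᶠ z in nhds x, h z = 0
    filter_upwards [Metric.ball_mem_nhds x hρ] with w hw
    by_contra hwne
    obtain ⟨ho, hc⟩ := aux_line_pre x x₁ (w - x₁) ρ
    have hd := aux_line_diff (hh.mono hb) x₁ (w - x₁)
    have h1 := aux_identity ho hc hd (z₀ := 0) (z₁ := 1) (by simpa using hx₁)
      (by simpa using hw) (by simpa using hwne)
    have h2 : ∀ᶠ t : ℂ in nhds 0, h (x₁ + t • (w - x₁)) = 0 := by
      have : Filter.Tendsto (fun t : ℂ => x₁ + t • (w - x₁)) (nhds 0) (nhds x₁) := by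
        have : Continuous (fun t : ℂ => x₁ + t • (w - x₁)) := by fun_prop
        simpa using this.tendsto 0
      exact this.eventually hx₁A
    have h3 := h1.and (h2.filter_mono nhdsWithin_le_nhds)
    obtain ⟨t, ht⟩ := h3.exists
    exact ht.1 ht.2

lemma aux_average {U : Set ℂ} (hU : IsOpen U) (hc : IsPreconnected U) {G H : ℂ → ℂ}
    (hG : DifferentiableOn ℂ G U) (hH : DifferentiableOn ℂ H U) {C : ℝ}
    (hC : ∀ z ∈ U, ‖G z‖ ≤ C * ‖H z‖) {r : ℝ} (hr : 0 < r)
    (hrU : Metric.closedBall 0 r ⊆ U) (h0 : H 0 ≠ 0) (hs : ∀ z ∈ Metric.sphere (0 : ℂ) r, H z ≠ 0) :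
    Real.circleAverage (fun z => G z / H z) 0 r = G 0 / H 0 := by
  classical
  have h0U : (0 : ℂ) ∈ U := hrU (by simp [hr.le])
  let q : ℂ → ℂ := fun z => G z / H z
  let u : ℂ → ℂ := fun z => if H z = 0 then Filter.limUnder (nhdsWithin z {z}ᶜ) q else q z
  have hu : DifferentiableOn ℂ u U := by
    intro z hz
    apply DifferentiableAt.differentiableWithinAt
    have hHz := hH.differentiableAt (hU.mem_nhds hz)
    by_cases hz0 : H z = 0
    · have h1 := aux_identity hU hc hH hz h0U h0
      rw [eventually_nhdsWithin_iff] at h1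
      have h2 := h1.and (hU.mem_nhds hz)
      set s := {x | (x ∈ ({z}ᶜ : Set ℂ) → H x ≠ 0) ∧ U x} with hsdef
      have hsn : s ∈ nhds z := h2
      have hd : DifferentiableOn ℂ q (s \ {z}) := by
        rintro w ⟨⟨hw1, hw2⟩, hw3⟩
        have := hU.mem_nhds hw2
        exact ((hG.differentiableAt this).div (hH.differentiableAt this)
          (hw1 hw3)).differentiableWithinAt
      have hb : BddAbove (norm ∘ q '' (s \ {z})) := by
        refine ⟨C, ?_⟩
        rintro _ ⟨w, ⟨⟨hw1, hw2⟩, hw3⟩, rfl⟩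
        have hpos : 0 < ‖H w‖ := norm_pos_iff.2 (hw1 hw3)
        simp only [Function.comp, q, norm_div]
        rw [div_le_iff₀ hpos]
        exact hC w hw2
      have := Complex.differentiableOn_update_limUnder_of_bddAbove hsn hd hb
      refine (this.differentiableAt hsn).congr_of_eventuallyEq ?_
      filter_upwards [hsn] with w hw
      by_cases hwz : w = z
      · subst hwz; simp [u, hz0]
      · have := hw.1 hwz
        simp [u, this, hwz]
    · have hev : ∀ᶠ w in nhds z, H w ≠ 0 := hHz.continuousAt.eventually_ne hz0
      refine ((hG.differentiableAt (hU.mem_nhds hz)).div hHz hz0).congr_of_eventuallyEq ?_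
      filter_upwards [hev] with w hw
      simp [u, hw, q]
  have e1 : Real.circleAverage (fun z => G z / H z) 0 r = Real.circleAverage u 0 r := by
    apply Real.circleAverage_congr_sphere
    intro z hz
    rw [abs_of_pos hr] at hz
    simp [u, hs z hz, q]
  rw [e1]
  have := (hu.diffContOnCl_ball hrU)
  rw [← abs_of_pos hr] at this
  rw [this.circleAverage]
  simp [u, h0, q]


lemma aux_param {n : ℕ} {W : Set (Fin n → ℂ)} (hW : IsOpen W) {q : (Fin n → ℂ) → ℂ}
    (hq : DifferentiableOn ℂ q W) (x₀ v : Fin n → ℂ) {r : ℝ} (hr : 0 ≤ r)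
    (hx : ∀ t ∈ Metric.sphere (0 : ℂ) r, x₀ + t • v ∈ W) :
    DifferentiableAt ℂ (fun x => Real.circleAverage (fun t => q (x + t • v)) 0 r) x₀ := by
  let K : Set (Fin n → ℂ) := (fun t : ℂ => x₀ + t • v) '' Metric.sphere (0 : ℂ) r
  have hK : IsCompact K := (isCompact_sphere (0 : ℂ) r).image (by fun_prop)
  have hKW : K ⊆ W := by rintro _ ⟨t, ht, rfl⟩; exact hx t ht
  obtain ⟨δ, hδ, hδW⟩ := hK.exists_cthickening_subset_open hW hKW
  have hcomp : IsCompact (Metric.cthickening δ K) := hK.cthickening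
  obtain ⟨M, hM⟩ := hcomp.exists_bound_of_continuousOn (hq.continuousOn.mono hδW)
  have hc : ∀ θ : ℝ, circleMap 0 r θ ∈ Metric.sphere (0 : ℂ) r := circleMap_mem_sphere 0 hr
  have key : ∀ x ∈ Metric.ball x₀ (δ/2), ∀ θ : ℝ,
      Metric.ball (x + circleMap 0 r θ • v) (δ/2) ⊆ Metric.cthickening δ K := by
    intro x hx θ y hy
    refine Metric.mem_cthickening_of_dist_le y (x₀ + circleMap 0 r θ • v) δ K
      ⟨_, hc θ, rfl⟩ ?_
    have h1 : dist (x + circleMap 0 r θ • v) (x₀ + circleMap 0 r θ • v) = dist x x₀ := by simp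
    have h2 := dist_triangle y (x + circleMap 0 r θ • v) (x₀ + circleMap 0 r θ • v)
    rw [Metric.mem_ball] at hx hy
    linarith
  have hcont : ∀ x ∈ Metric.ball x₀ (δ/2), Continuous fun θ : ℝ => q (x + circleMap 0 r θ • v) := by
    intro x hx
    refine hq.continuousOn.comp_continuous (f := fun θ : ℝ => x + circleMap 0 r θ • v)
      (by fun_prop) ?_
    intro θ
    exact hδW (key x hx θ (Metric.mem_ball_self (by positivity)))
  unfold Real.circleAverage
  apply DifferentiableAt.const_smul
  simp only [intervalIntegral.integral_of_le Real.two_pi_pos.le]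
  have hmain := hasFDerivAt_integral_of_dominated_of_fderiv_le (𝕜 := ℂ)
    (μ := MeasureTheory.volume.restrict (Set.Ioc 0 (2 * Real.pi)))
    (F := fun x θ => q (x + circleMap 0 r θ • v))
    (F' := fun x θ => fderiv ℂ q (x + circleMap 0 r θ • v))
    (x₀ := x₀) (s := Metric.ball x₀ (δ/2)) (bound := fun _ => (2 * M) / (δ/2))
    (Metric.ball_mem_nhds _ (by positivity)) ?_ ?_ ?_ ?_ ?_ ?_
  · exact hmain.differentiableAt
  · filter_upwards [Metric.ball_mem_nhds x₀ (half_pos hδ)] with x hx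
    exact (hcont x hx).aestronglyMeasurable
  · exact ((hcont x₀ (Metric.mem_ball_self (half_pos hδ))).integrableOn_Ioc)
  · have : Measurable fun θ : ℝ => fderiv ℂ q (x₀ + circleMap 0 r θ • v) :=
      (measurable_fderiv ℂ q).comp
        (by fun_prop : Continuous fun θ : ℝ => x₀ + circleMap 0 r θ • v).measurable
    exact this.aestronglyMeasurable
  · refine Filter.Eventually.of_forall fun θ x hx => ?_
    have hk := key x hx θ
    refine Complex.norm_fderiv_le_div_of_mapsTo_ball (hq.mono (hk.trans hδW)) ?_ (half_pos hδ)
    intro y hy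
    rw [Metric.mem_closedBall, dist_eq_norm]
    refine (norm_sub_le _ _).trans ?_
    have := hM _ (hk hy)
    have := hM _ (hk (Metric.mem_ball_self (half_pos hδ)))
    linarith
  · exact MeasureTheory.integrable_const _
  · refine Filter.Eventually.of_forall fun θ x hx => ?_
    have hk := hδW (key x hx θ (Metric.mem_ball_self (half_pos hδ)))
    exact (hasFDerivAt_comp_add_right _).2 (hq.differentiableAt (hW.mem_nhds hk)).hasFDerivAt

lemma aux_local {n : ℕ} {p : Fin n → ℂ} {ρ : ℝ} {g h : (Fin n → ℂ) → ℂ}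
    (hρ : 0 < ρ)
    (hg : DifferentiableOn ℂ g (Metric.ball p ρ)) (hh : DifferentiableOn ℂ h (Metric.ball p ρ))
    {C : ℝ} (hC : ∀ x ∈ Metric.ball p ρ, ‖g x‖ ≤ C * ‖h x‖)
    (hne : ∃ x ∈ Metric.ball p ρ, h x ≠ 0) :
    ∃ δ, 0 < δ ∧ δ ≤ ρ ∧ ∃ f : (Fin n → ℂ) → ℂ, DifferentiableOn ℂ f (Metric.ball p δ) ∧
      ∀ x ∈ Metric.ball p δ, h x ≠ 0 → f x = g x / h x := by
  obtain ⟨y, hy, hyne⟩ := hne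
  set v := y - p with hv
  obtain ⟨ho, hc⟩ := aux_line_pre p p v ρ
  have h1 := aux_identity ho hc (aux_line_diff hh p v) (z₀ := 0) (z₁ := 1)
    (by simpa using hρ) (by simpa [hv, dist_eq_norm] using hy) (by simpa [hv] using hyne)
  rw [eventually_nhdsWithin_iff, Metric.eventually_nhds_iff] at h1
  obtain ⟨ε, hε, h1⟩ := h1
  obtain ⟨r, hr, hrε, hrv⟩ : ∃ r : ℝ, 0 < r ∧ r < ε ∧ r * ‖v‖ < ρ / 2 := by
    refine ⟨min (ε / 2) (ρ / 4 / (‖v‖ + 1)), by positivity, ?_, ?_⟩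
    · exact (min_le_left _ _).trans_lt (by linarith)
    · calc min (ε / 2) (ρ / 4 / (‖v‖ + 1)) * ‖v‖ ≤ (ρ / 4 / (‖v‖ + 1)) * (‖v‖ + 1) := by
            gcongr
            · exact min_le_right _ _
            · linarith
        _ = ρ / 4 := by field_simp
        _ < ρ / 2 := by linarith
  have hball : ∀ x ∈ Metric.ball p (ρ / 2), ∀ t : ℂ, ‖t‖ ≤ r → x + t • v ∈ Metric.ball p ρ := by
    intro x hx t ht
    rw [Metric.mem_ball, dist_eq_norm] at *
    calc ‖x + t • v - p‖ = ‖(x - p) + t • v‖ := by congr 1; abel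
      _ ≤ ‖x - p‖ + ‖t‖ * ‖v‖ := by rw [← norm_smul]; exact norm_add_le _ _
      _ ≤ ‖x - p‖ + r * ‖v‖ := by gcongr
      _ < ρ := by linarith
  let W : Set (Fin n → ℂ) := {x | x ∈ Metric.ball p ρ ∧ h x ≠ 0}
  have hW : IsOpen W := hh.continuousOn.isOpen_inter_preimage Metric.isOpen_ball isOpen_ne
  have hqW : DifferentiableOn ℂ (fun x => g x / h x) W := by
    simp only [div_eq_mul_inv]
    exact (hg.mono fun x (hx : x ∈ W) => hx.1).mul
      ((hh.mono fun x (hx : x ∈ W) => hx.1).inv fun x (hx : x ∈ W) => hx.2)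
  have hpW : ∀ t ∈ Metric.sphere (0 : ℂ) r, p + t • v ∈ W := by
    intro t ht
    have ht' : ‖t‖ = r := by simpa using ht
    refine ⟨hball p (Metric.mem_ball_self (half_pos hρ)) t ht'.le, h1 (y := t) ?_ ?_⟩
    · simpa [ht'] using hrε
    · rintro rfl
      simp at ht'
      exact hr.ne ht'
  have hev : ∀ᶠ x in nhds p, ∀ t ∈ Metric.sphere (0 : ℂ) r, x + t • v ∈ W := by
    apply (isCompact_sphere (0 : ℂ) r).eventually_forall_of_forall_eventually
    intro t ht
    have hct : Continuous fun z : (Fin n → ℂ) × ℂ => z.1 + z.2 • v := by fun_prop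
    exact hct.continuousAt.eventually (hW.mem_nhds (hpW t ht))
  obtain ⟨δ₁, hδ₁, hW₁⟩ := Metric.eventually_nhds_iff_ball.1 hev
  refine ⟨min δ₁ (ρ / 2), by positivity, (min_le_right _ _).trans (by linarith),
    fun x => Real.circleAverage (fun t => (fun x => g x / h x) (x + t • v)) 0 r, ?_, ?_⟩
  · intro x hx
    have hx1 := Metric.ball_subset_ball (min_le_left _ _) hx
    exact (aux_param hW hqW x v hr.le (hW₁ x hx1)).differentiableWithinAt
  · intro x hx hx0
    have hx1 := Metric.ball_subset_ball (min_le_left _ _) hx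
    have hx2 := Metric.ball_subset_ball (min_le_right _ _) hx
    obtain ⟨ho, hc⟩ := aux_line_pre p x v ρ
    have := aux_average ho hc (aux_line_diff hg x v) (aux_line_diff hh x v) (C := C)
      (fun t ht => hC _ ht) hr (fun t ht => hball x hx2 t (by simpa using ht))
      (by simpa using hx0) (fun t ht => (hW₁ x hx1 t ht).2)
    simpa using this

open Polynomial in
lemma aux_coeff {d : ℕ} (hd : 0 < d) (c : Fin d → ℂ) {B : ℝ}
    (hB : ∀ y : ℂ, y ^ d + ∑ i : Fin d, c i * y ^ (d - 1 - i.val) = 0 → ‖y‖ ≤ B) (i : Fin d) :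
    ‖c i‖ ≤ max B 1 ^ d * d.choose (d / 2) := by
  let Q : ℂ[X] := ∑ i : Fin d, C (c i) * X ^ (d - 1 - i.val)
  have hQ : Q.degree < d := by
    refine (degree_sum_le _ _).trans_lt ?_
    rw [Finset.sup_lt_iff (by exact_mod_cast WithBot.bot_lt_coe d)]
    intro j _
    refine (degree_C_mul_X_pow_le _ _).trans_lt ?_
    exact_mod_cast (by omega : d - 1 - j.val < d)
  have hm : (X ^ d + Q).Monic := monic_X_pow_add hQ
  have hnd : (X ^ d + Q).natDegree ≤ d := by
    rw [natDegree_le_iff_degree_le]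
    refine (degree_add_le _ _).trans (max_le (degree_X_pow_le _) hQ.le)
  have := coeff_bdd_of_roots_le (B := B) (RingHom.id ℂ) hm (IsAlgClosed.splits _) hnd ?_
    (d - 1 - i.val)
  · have e : (Polynomial.map (RingHom.id ℂ) (X ^ d + Q)).coeff (d - 1 - i.val) = c i := ?_
    · rwa [e] at this
    rw [Polynomial.map_id, coeff_add, coeff_X_pow, if_neg (by omega), zero_add, finsetSum_coeff,
      Finset.sum_eq_single i]
    · simp
    · intro j _ hj
      rw [coeff_C_mul_X_pow, if_neg]
      intro h
      apply hj
      ext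
      omega
    · simp
  · intro z hz
    rw [Polynomial.map_id, mem_roots hm.ne_zero, IsRoot.def] at hz
    apply hB
    simpa [Q, eval_finsetSum] using hz

/-- if `Z ⊆ D × ℂ` is closed in `D × ℂ` with proper projection
to the domain `D ⊆ ℂ^n`, and over the complement of a closed nowhere dense
subset `S ⊆ D` it is the zero set of a monic polynomial
`P(x,y) = y^d + a_1(x) y^{d-1} + ⋯ + a_d(x)` whose coefficients `a_i` are
holomorphic on `D ∖ S` and meromorphic on `D`, then the coefficients `a_i`
extend holomorphically to all of `D`. -/
theorem monic_coefficients_extend_holomorphically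
    (n d : ℕ) (hd : 0 < d)
    (D : Set (Fin n → ℂ)) (hDo : IsOpen D) (hDc : IsConnected D)
    (S : Set (Fin n → ℂ)) (hSsub : S ⊆ D)
    (hScl : closure S ∩ D ⊆ S) (hSthin : interior S = ∅)
    (Z : Set ((Fin n → ℂ) × ℂ)) (hZD : ∀ p ∈ Z, p.1 ∈ D)
    (hZcl : ∀ p : (Fin n → ℂ) × ℂ, p.1 ∈ D → p ∈ closure Z → p ∈ Z)
    (hproper : ∀ K : Set (Fin n → ℂ), IsCompact K → K ⊆ D →
      IsCompact {p : (Fin n → ℂ) × ℂ | p ∈ Z ∧ p.1 ∈ K})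
    (a : Fin d → (Fin n → ℂ) → ℂ)
    (ha : ∀ i, DifferentiableOn ℂ (a i) (D \ S))
    (hmero : ∀ i, ∃ g h : (Fin n → ℂ) → ℂ,
      DifferentiableOn ℂ g D ∧ DifferentiableOn ℂ h D ∧ (∃ x ∈ D, h x ≠ 0) ∧
      ∀ x ∈ D \ S, h x * a i x = g x)
    (hZeq : ∀ x ∈ D \ S, ∀ y : ℂ,
      ((x, y) ∈ Z ↔ y ^ d + ∑ i : Fin d, a i x * y ^ (d - 1 - i.val) = 0)) :
    ∀ i : Fin d, ∃ aext : (Fin n → ℂ) → ℂ,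
      DifferentiableOn ℂ aext D ∧ Set.EqOn aext (a i) (D \ S) := by
  have hopen : IsOpen (D \ S) := by
    have : D \ S = D ∩ (closure S)ᶜ := by
      ext x
      constructor
      · rintro ⟨h1, h2⟩
        exact ⟨h1, fun h3 => h2 (hScl ⟨h3, h1⟩)⟩
      · rintro ⟨h1, h2⟩
        exact ⟨h1, fun h3 => h2 (subset_closure h3)⟩
    rw [this]
    exact hDo.inter isClosed_closure.isOpen_compl
  have hthin : ∀ U : Set (Fin n → ℂ), IsOpen U → U ⊆ S → ∀ x, x ∉ U := by
    intro U hU hUS x hx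
    have := interior_maximal hUS hU hx
    rw [hSthin] at this
    exact this
  intro i
  obtain ⟨g, h, hg, hh, hne, hgh⟩ := hmero i
  have hlocal : ∀ p ∈ D, ∃ δ, 0 < δ ∧ Metric.ball p δ ⊆ D ∧ ∃ f : (Fin n → ℂ) → ℂ,
      DifferentiableOn ℂ f (Metric.ball p δ) ∧ ∀ x ∈ Metric.ball p δ, x ∉ S → f x = a i x := by
    intro p hp
    obtain ⟨ρ, hρ, hρD⟩ := Metric.nhds_basis_closedBall.mem_iff.1 (hDo.mem_nhds hp)
    have hbD : Metric.ball p ρ ⊆ D := Metric.ball_subset_closedBall.trans hρD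
    obtain ⟨B, hB⟩ := (hproper _ (isCompact_closedBall p ρ) hρD).exists_bound_of_continuousOn
      (f := fun z : (Fin n → ℂ) × ℂ => z.2) continuous_snd.continuousOn
    set C : ℝ := max B 1 ^ d * d.choose (d / 2) with hCdef
    have ha_bd : ∀ x ∈ Metric.ball p ρ, x ∉ S → ‖a i x‖ ≤ C := by
      intro x hx hxS
      refine aux_coeff hd (fun j => a j x) (B := B) ?_ i
      intro y hy
      exact hB (x, y) ⟨(hZeq x ⟨hbD hx, hxS⟩ y).2 hy, Metric.ball_subset_closedBall hx⟩
    have hgC : ∀ x ∈ Metric.ball p ρ, ‖g x‖ ≤ C * ‖h x‖ := by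
      intro x hx
      by_contra hcon
      have hcont : ContinuousOn (fun x => ‖g x‖ - C * ‖h x‖) (Metric.ball p ρ) :=
        (hg.mono hbD).continuousOn.norm.sub
          (continuousOn_const.mul (hh.mono hbD).continuousOn.norm)
      refine hthin _ (hcont.isOpen_inter_preimage Metric.isOpen_ball (isOpen_Ioi (a := (0 : ℝ))))
        ?_ x ⟨hx, ?_⟩
      · rintro z ⟨hz, hz2⟩
        by_contra hzS
        have h1 := hgh z ⟨hbD hz, hzS⟩
        have h2 := ha_bd z hz hzS
        have h3 : 0 < ‖g z‖ - C * ‖h z‖ := hz2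
        rw [← h1, norm_mul] at h3
        nlinarith [norm_nonneg (h z)]
      · show 0 < ‖g x‖ - C * ‖h x‖
        linarith
    have hne' : ∃ x ∈ Metric.ball p ρ, h x ≠ 0 := by
      obtain ⟨x, hx1, hx2⟩ := ((aux_dense hDo hDc.isPreconnected hh hne hp).and_eventually
        (Metric.ball_mem_nhds p hρ)).exists
      exact ⟨x, hx2, hx1⟩
    obtain ⟨δ, hδ, hδρ, f, hf, hfe⟩ := aux_local hρ (hg.mono hbD) (hh.mono hbD) hgC hne'
    have hδD : Metric.ball p δ ⊆ D := (Metric.ball_subset_ball hδρ).trans hbD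
    refine ⟨δ, hδ, hδD, f, hf, ?_⟩
    intro x hx hxS
    by_contra hxne
    have hU : Metric.ball p δ ∩ (D \ S) ∈ nhds x :=
      (Metric.isOpen_ball.inter hopen).mem_nhds ⟨hx, hδD hx, hxS⟩
    have hfc : ContinuousAt f x :=
      (hf.differentiableAt (Metric.isOpen_ball.mem_nhds hx)).continuousAt
    have hac : ContinuousAt (a i) x :=
      ((ha i).differentiableAt (hopen.mem_nhds ⟨hδD hx, hxS⟩)).continuousAt
    have hev : ∀ᶠ z in nhds x, f z ≠ a i z :=
      ((hfc.sub hac).eventually_ne (sub_ne_zero.2 hxne)).mono fun z hz => sub_ne_zero.1 hz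
    obtain ⟨z, hz1, hz2, hz3⟩ := ((aux_dense hDo hDc.isPreconnected hh hne
      (hδD hx)).and_eventually (hev.and hU)).exists
    apply hz2
    rw [hfe z hz3.1 hz1, ← hgh z hz3.2]
    field_simp
  choose! δ hδ hδD f hf hfe using hlocal
  refine ⟨fun x => f x x, ?_, ?_⟩
  · intro p hp
    have hpn : Metric.ball p (δ p) ∈ nhds p := Metric.ball_mem_nhds p (hδ p hp)
    refine (((hf p hp).differentiableAt hpn).congr_of_eventuallyEq ?_).differentiableWithinAt
    filter_upwards [hpn] with x hx
    have hxD := hδD p hp hx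
    by_contra hxne
    have h1 : ContinuousOn (fun z => f x z - f p z)
        (Metric.ball x (δ x) ∩ Metric.ball p (δ p)) :=
      ((hf x hxD).continuousOn.mono inter_subset_left).sub
        ((hf p hp).continuousOn.mono inter_subset_right)
    refine hthin _ (h1.isOpen_inter_preimage (Metric.isOpen_ball.inter Metric.isOpen_ball)
      (isOpen_ne (x := (0 : ℂ)))) ?_ x ⟨⟨Metric.mem_ball_self (hδ x hxD), hx⟩, ?_⟩
    · rintro z ⟨⟨hz1, hz2⟩, hz3⟩
      by_contra hzS
      apply hz3
      show f x z - f p z = 0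
      rw [hfe x hxD z hz1 hzS, hfe p hp z hz2 hzS, sub_self]
    · exact sub_ne_zero.2 hxne
  · rintro x ⟨hxD, hxS⟩
    exact hfe x hxD x (Metric.mem_ball_self (hδ x hxD)) hxS
end
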